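/- (Gramian exponential stability criterion via state feedback, continuous case.) Let A : ℝ → ℝ^{n×n} and B : ℝ → ℝ^{n×m} be continuous, let Φ_A be the state transition matrix of A, and fix δ > 0 and α > 0. Suppose there exist ε₁, ε₂ > 0 such that ε₁ I ≤ G_0(t, t+δ) ≤ ε₂ I in the Loewner order for all t ∈ ℝ. Then for each t the α-weighted Gramian G_α(t, t+δ) is invertible, and the state feedback gain K(t) := -B(t)ᵀ G_α(t, t+δ)^{-1} renders the closed-loop system uniformly exponentially stable with rate α: there exists γ > 0 such that every differentiable x : ℝ → ℝⁿ with x'(t) = [A(t) + B(t)K(t)] x(t) for all t satisfies ‖x(t)‖ ≤ γ e^{-α(t-t₀)} ‖x(t₀)‖ for all t ≥ t₀ and all t₀ ∈ ℝ. -/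

import Mathlib

open Matrix MeasureTheory

/-- The Euclidean norm on ℝⁿ. -/
noncomputable def euclNorm {n : ℕ} (x : Fin n → ℝ) : ℝ := Real.sqrt (∑ i, x i ^ 2)

/-- The α-weighted controllability Gramian on ℝ:
`G_α(t,T) = ∫_t^T e^{-4α(s-t)} Φ(t,s) B(s) B(s)ᵀ Φ(t,s)ᵀ ds` (entrywise integral). -/
noncomputable def cGram {n m : ℕ} (Φ : ℝ → ℝ → Matrix (Fin n) (Fin n) ℝ)
    (B : ℝ → Matrix (Fin n) (Fin m) ℝ) (α : ℝ) (t T : ℝ) : Matrix (Fin n) (Fin n) ℝ :=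
  Matrix.of fun i j =>
    ∫ s in t..T, Real.exp (-(4 * α) * (s - t)) * ((Φ t s * B s * (B s)ᵀ * (Φ t s)ᵀ) i j)

/-- Entrywise product rule for matrix-valued functions. -/
theorem hasDerivAt_entry_mul {k l p : ℕ} {M : ℝ → Matrix (Fin k) (Fin l) ℝ}
    {N : ℝ → Matrix (Fin l) (Fin p) ℝ} {M' : Matrix (Fin k) (Fin l) ℝ}
    {N' : Matrix (Fin l) (Fin p) ℝ} {t : ℝ}
    (hM : ∀ i j, HasDerivAt (fun s => M s i j) (M' i j) t)
    (hN : ∀ i j, HasDerivAt (fun s => N s i j) (N' i j) t) (i : Fin k) (j : Fin p) :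
    HasDerivAt (fun s => (M s * N s) i j) ((M' * N t + M t * N') i j) t := by
  simp only [Matrix.mul_apply, Matrix.add_apply, ← Finset.sum_add_distrib]
  exact HasDerivAt.fun_sum fun a _ => (hM i a).mul (hN a j)

/-- Continuity of the inverse of a matrix-valued function with continuous entries. -/
theorem continuousAt_right_inverse {n : ℕ} {P Q : ℝ → Matrix (Fin n) (Fin n) ℝ} {t : ℝ}
    (hP : ∀ i j, ContinuousAt (fun s => P s i j) t) (hPQ : ∀ s, P s * Q s = 1) :
    ContinuousAt Q t := by
  have hQ : Q = fun s => (P s)⁻¹ := funext fun s => (Matrix.inv_eq_right_inv (hPQ s)).symm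
  have hdet : (P t).det ≠ 0 := by
    have h := congrArg Matrix.det (hPQ t)
    rw [Matrix.det_mul, Matrix.det_one] at h
    exact left_ne_zero_of_mul_eq_one h
  have hPc : ContinuousAt P t := continuousAt_pi.2 fun i => continuousAt_pi.2 fun j => hP i j
  rw [hQ]
  refine ContinuousAt.comp (f := P) (g := fun M : Matrix (Fin n) (Fin n) ℝ => M⁻¹) ?_ hPc
  refine continuousAt_matrix_inv _ ?_
  simpa [Ring.inverse_eq_inv'] using continuousAt_inv₀ hdet

/-- Entrywise derivative of the inverse of a matrix-valued function. -/
theorem hasDerivAt_entry_right_inverse {n : ℕ} {P Q : ℝ → Matrix (Fin n) (Fin n) ℝ}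
    {P' : Matrix (Fin n) (Fin n) ℝ} {t : ℝ}
    (hP : ∀ i j, HasDerivAt (fun s => P s i j) (P' i j) t) (hPQ : ∀ s, P s * Q s = 1)
    (i j : Fin n) : HasDerivAt (fun s => Q s i j) ((-(Q t * P' * Q t)) i j) t := by
  have hQc : ContinuousAt Q t :=
    continuousAt_right_inverse (fun i j => (hP i j).continuousAt) hPQ
  have hQ : Filter.Tendsto Q (nhdsWithin t {t}ᶜ) (nhds (Q t)) :=
    hQc.tendsto.mono_left nhdsWithin_le_nhds
  have hslope : Filter.Tendsto (fun s => (s - t)⁻¹ • (P s - P t)) (nhdsWithin t {t}ᶜ)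
      (nhds P') := by
    refine tendsto_pi_nhds.2 fun a => tendsto_pi_nhds.2 fun b => ?_
    simpa [slope_fun_def] using hasDerivAt_iff_tendsto_slope.1 (hP a b)
  have hlim : Filter.Tendsto (fun s => -(Q s * ((s - t)⁻¹ • (P s - P t)) * Q t))
      (nhdsWithin t {t}ᶜ) (nhds (-(Q t * P' * Q t))) :=
    ((hQ.mul hslope).mul tendsto_const_nhds).neg
  refine hasDerivAt_iff_tendsto_slope.2 ?_
  refine ((tendsto_pi_nhds.1 (tendsto_pi_nhds.1 hlim i) j)).congr fun s => ?_
  have hs : Q s * P s = 1 := mul_eq_one_comm.1 (hPQ s)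
  have key : -(Q s * ((s - t)⁻¹ • (P s - P t)) * Q t) = (s - t)⁻¹ • (Q s - Q t) := by
    rw [Matrix.mul_smul, Matrix.smul_mul, ← smul_neg, mul_sub, sub_mul, hs, one_mul,
      mul_assoc, hPQ t, mul_one, neg_sub]
  rw [key]
  simp [slope_fun_def]

/-- Entrywise derivative of an exponentially weighted integral over a sliding window. -/
theorem hasDerivAt_weighted_window {g : ℝ → ℝ} (hg : Continuous g) (c δ t : ℝ) :
    HasDerivAt (fun τ => ∫ s in τ..(τ + δ), Real.exp (-c * (s - τ)) * g s)
      (c * (∫ s in t..(t + δ), Real.exp (-c * (s - t)) * g s)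
        + (Real.exp (-c * δ) * g (t + δ) - g t)) t := by
  have hsplit : ∀ τ, (∫ s in τ..(τ + δ), Real.exp (-c * (s - τ)) * g s)
      = Real.exp (c * τ) * ∫ s in τ..(τ + δ), Real.exp (-c * s) * g s := by
    intro τ
    rw [← intervalIntegral.integral_const_mul]
    refine intervalIntegral.integral_congr fun s _ => ?_
    rw [← mul_assoc, ← Real.exp_add]
    ring_nf
  have hc : Continuous fun s => Real.exp (-c * s) * g s := by fun_prop
  have hF : ∀ u, HasDerivAt (fun u => ∫ s in (0 : ℝ)..u, Real.exp (-c * s) * g s)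
      (Real.exp (-c * u) * g u) u := fun u => hc.integral_hasStrictDerivAt 0 u |>.hasDerivAt
  have hdiff : ∀ τ, (∫ s in τ..(τ + δ), Real.exp (-c * s) * g s)
      = (∫ s in (0 : ℝ)..(τ + δ), Real.exp (-c * s) * g s)
        - ∫ s in (0 : ℝ)..τ, Real.exp (-c * s) * g s := fun τ =>
    (intervalIntegral.integral_interval_sub_left (hc.intervalIntegrable _ _)
      (hc.intervalIntegrable _ _)).symm
  have hexp : HasDerivAt (fun τ => Real.exp (c * τ)) (Real.exp (c * t) * c) t := by
    simpa using ((hasDerivAt_id t).const_mul c).exp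
  have hmain := hexp.mul (((hF (t + δ)).comp_add_const t δ).sub (hF t))
  rw [hsplit t]
  refine (hmain.congr_of_eventuallyEq (Filter.Eventually.of_forall fun τ => ?_)).congr_deriv ?_
  · simp only [hsplit τ, hdiff τ, Pi.mul_apply, Pi.sub_apply]
  · rw [hdiff t]
    have e1 : Real.exp (-c * (t + δ)) = Real.exp (-c * δ) * (Real.exp (c * t))⁻¹ := by
      rw [← Real.exp_neg, ← Real.exp_add]; ring_nf
    have e2 : Real.exp (-c * t) = (Real.exp (c * t))⁻¹ := by
      rw [← Real.exp_neg]; ring_nf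
    rw [e1, e2]
    simp only [Pi.sub_apply]
    field_simp

/-- Quadratic form of the weighted Gramian as an integral of squares. -/
theorem dotProduct_cGram_mulVec {n m : ℕ} {Φ : ℝ → ℝ → Matrix (Fin n) (Fin n) ℝ}
    {B : ℝ → Matrix (Fin n) (Fin m) ℝ} (hB : Continuous B) {t : ℝ}
    (hΦ : Continuous (Φ t)) (α T : ℝ) (v : Fin n → ℝ) :
    v ⬝ᵥ (cGram Φ B α t T *ᵥ v) = ∫ s in t..T, Real.exp (-(4 * α) * (s - t)) *
      (((Φ t s * B s)ᵀ *ᵥ v) ⬝ᵥ ((Φ t s * B s)ᵀ *ᵥ v)) := by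
  have hN : ∀ i j, Continuous fun s => (Φ t s * B s * (B s)ᵀ * (Φ t s)ᵀ) i j := fun i j =>
    ((((hΦ.matrix_mul hB).matrix_mul hB.matrix_transpose).matrix_mul
      hΦ.matrix_transpose).matrix_elem i j)
  have hsq : ∀ s, ((Φ t s * B s)ᵀ *ᵥ v) ⬝ᵥ ((Φ t s * B s)ᵀ *ᵥ v)
      = ∑ i, ∑ j, v i * ((Φ t s * B s * (B s)ᵀ * (Φ t s)ᵀ) i j * v j) := by
    intro s
    have h : Φ t s * B s * (B s)ᵀ * (Φ t s)ᵀ = (Φ t s * B s) * (Φ t s * B s)ᵀ := by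
      rw [Matrix.transpose_mul, Matrix.mul_assoc]
    rw [h]
    simp only [← Finset.mul_sum]
    change _ = v ⬝ᵥ (((Φ t s * B s) * (Φ t s * B s)ᵀ) *ᵥ v)
    rw [← Matrix.mulVec_mulVec, Matrix.dotProduct_mulVec v, Matrix.mulVec_transpose]
  simp only [hsq]
  simp only [Finset.mul_sum]
  rw [intervalIntegral.integral_finsetSum fun i _ =>
    (Continuous.intervalIntegrable (by fun_prop) _ _)]
  simp only [dotProduct, mulVec, Finset.mul_sum]
  refine Finset.sum_congr rfl fun i _ => ?_
  rw [intervalIntegral.integral_finsetSum fun j _ =>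
    (Continuous.intervalIntegrable (by fun_prop) _ _)]
  refine Finset.sum_congr rfl fun j _ => ?_
  simp only [cGram, Matrix.of_apply]
  rw [← intervalIntegral.integral_mul_const, ← intervalIntegral.integral_const_mul]
  refine intervalIntegral.integral_congr fun s _ => ?_
  ring

theorem cGram_transpose {n m : ℕ} (Φ : ℝ → ℝ → Matrix (Fin n) (Fin n) ℝ)
    (B : ℝ → Matrix (Fin n) (Fin m) ℝ) (α t T : ℝ) :
    (cGram Φ B α t T)ᵀ = cGram Φ B α t T := by
  ext i j
  simp only [cGram, Matrix.transpose_apply, Matrix.of_apply]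
  refine intervalIntegral.integral_congr fun s _ => ?_
  have h : (Φ t s * B s * (B s)ᵀ * (Φ t s)ᵀ)ᵀ = Φ t s * B s * (B s)ᵀ * (Φ t s)ᵀ := by
    simp [Matrix.mul_assoc]
  exact congrArg _ (congrFun (congrFun h i) j)

/-- The weight `e^{-4α(s-t)}` lies between `e^{-4αδ}` and `1` on the window, so the weighted
Gramian is comparable to the unweighted one. -/
theorem cGram_weight_bounds {n m : ℕ} {Φ : ℝ → ℝ → Matrix (Fin n) (Fin n) ℝ}
    {B : ℝ → Matrix (Fin n) (Fin m) ℝ} (hB : Continuous B) {t : ℝ}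
    (hΦ : Continuous (Φ t)) {α δ : ℝ} (hα : 0 ≤ α) (hδ : 0 ≤ δ) (v : Fin n → ℝ) :
    Real.exp (-(4 * α) * δ) * (v ⬝ᵥ (cGram Φ B 0 t (t + δ) *ᵥ v))
        ≤ v ⬝ᵥ (cGram Φ B α t (t + δ) *ᵥ v) ∧
      v ⬝ᵥ (cGram Φ B α t (t + δ) *ᵥ v) ≤ v ⬝ᵥ (cGram Φ B 0 t (t + δ) *ᵥ v) := by
  rw [dotProduct_cGram_mulVec hB hΦ, dotProduct_cGram_mulVec hB hΦ,
    ← intervalIntegral.integral_const_mul]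
  have hq : Continuous fun s => ((Φ t s * B s)ᵀ *ᵥ v) ⬝ᵥ ((Φ t s * B s)ᵀ *ᵥ v) := by
    have h : Continuous fun s => (Φ t s * B s)ᵀ *ᵥ v :=
      ((hΦ.matrix_mul hB).matrix_transpose).matrix_mulVec continuous_const
    exact h.dotProduct h
  have hnn : ∀ s, 0 ≤ ((Φ t s * B s)ᵀ *ᵥ v) ⬝ᵥ ((Φ t s * B s)ᵀ *ᵥ v) := fun s =>
    Finset.sum_nonneg fun i _ => mul_self_nonneg _
  constructor <;>
  refine intervalIntegral.integral_mono_on (by linarith)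
    (Continuous.intervalIntegrable (by fun_prop) _ _)
    (Continuous.intervalIntegrable (by fun_prop) _ _) fun s hs => ?_
  · rw [← mul_assoc, ← Real.exp_add]
    refine mul_le_mul_of_nonneg_right (Real.exp_le_exp.2 ?_) (hnn s)
    nlinarith [hs.2]
  · refine mul_le_mul_of_nonneg_right (Real.exp_le_exp.2 ?_) (hnn s)
    nlinarith [mul_nonneg hα (sub_nonneg.2 hs.1)]

/-- The differential Lyapunov equation satisfied by the sliding-window weighted Gramian. -/
theorem hasDerivAt_cGram {n m : ℕ} {A : ℝ → Matrix (Fin n) (Fin n) ℝ}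
    {B : ℝ → Matrix (Fin n) (Fin m) ℝ} (hB : Continuous B)
    {Φ : ℝ → ℝ → Matrix (Fin n) (Fin n) ℝ}
    (hΦderiv : ∀ s t : ℝ, ∀ i j, HasDerivAt (fun τ => Φ τ s i j) ((A t * Φ t s) i j) t)
    (hΦmul : ∀ t s r : ℝ, Φ t s * Φ s r = Φ t r)
    (hΦinv : ∀ t s : ℝ, Φ t s * Φ s t = 1)
    (hΦ : ∀ t, Continuous (Φ t)) (α δ t : ℝ) (i j : Fin n) :
    HasDerivAt (fun τ => cGram Φ B α τ (τ + δ) i j)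
      ((A t * cGram Φ B α t (t + δ) + cGram Φ B α t (t + δ) * (A t)ᵀ
        + (4 * α) • cGram Φ B α t (t + δ)
        + Real.exp (-(4 * α) * δ) • ((Φ t (t + δ) * B (t + δ)) * (Φ t (t + δ) * B (t + δ))ᵀ)
        - B t * (B t)ᵀ) i j) t := by
  set N : ℝ → Matrix (Fin n) (Fin n) ℝ := fun s => Φ 0 s * B s * (B s)ᵀ * (Φ 0 s)ᵀ with hNdef
  have hN : ∀ a b, Continuous fun s => N s a b := fun a b =>
    (((((hΦ 0).matrix_mul hB).matrix_mul hB.matrix_transpose).matrix_mul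
      (hΦ 0).matrix_transpose).matrix_elem a b)
  set M : ℝ → Matrix (Fin n) (Fin n) ℝ := fun τ => Matrix.of fun a b =>
    ∫ s in τ..(τ + δ), Real.exp (-(4 * α) * (s - τ)) * N s a b with hMdef
  have hconj : ∀ τ s, Φ τ s * B s * (B s)ᵀ * (Φ τ s)ᵀ = Φ τ 0 * N s * (Φ τ 0)ᵀ := by
    intro τ s
    rw [← hΦmul τ 0 s]
    simp only [hNdef, Matrix.transpose_mul, Matrix.mul_assoc]
  have hW : ∀ τ, cGram Φ B α τ (τ + δ) = Φ τ 0 * M τ * (Φ τ 0)ᵀ := by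
    intro τ
    ext a b
    simp only [cGram, hMdef, Matrix.of_apply, hconj]
    simp only [Matrix.mul_apply, Matrix.of_apply, Matrix.transpose_apply,
      Finset.mul_sum, Finset.sum_mul]
    rw [intervalIntegral.integral_finsetSum fun i _ =>
      (Continuous.intervalIntegrable (by fun_prop) _ _)]
    refine Finset.sum_congr rfl fun c _ => ?_
    rw [intervalIntegral.integral_finsetSum fun i _ =>
      (Continuous.intervalIntegrable (by fun_prop) _ _)]
    refine Finset.sum_congr rfl fun d _ => ?_
    rw [← intervalIntegral.integral_const_mul, ← intervalIntegral.integral_mul_const]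
    refine intervalIntegral.integral_congr fun s _ => ?_
    ring
  have hM : ∀ a b, HasDerivAt (fun τ => M τ a b)
      (((4 * α) • M t + (Real.exp (-(4 * α) * δ) • N (t + δ) - N t)) a b) t := fun a b =>
    hasDerivAt_weighted_window (hN a b) (4 * α) δ t
  have hmain := hasDerivAt_entry_mul (hasDerivAt_entry_mul (hΦderiv 0 t) hM)
    (N := fun τ => (Φ τ 0)ᵀ) (N' := (A t * Φ t 0)ᵀ) (fun a b => hΦderiv 0 t b a) i j
  simp only [hW]
  have h1 : (Φ t (t + δ) * B (t + δ)) * (Φ t (t + δ) * B (t + δ))ᵀ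
      = Φ t 0 * N (t + δ) * (Φ t 0)ᵀ := by
    rw [← hconj, Matrix.transpose_mul, ← Matrix.mul_assoc]
  have h2 : B t * (B t)ᵀ = Φ t 0 * N t * (Φ t 0)ᵀ := by
    have h0 : Φ t t = 1 := by rw [← hΦmul t 0 t, hΦinv]
    rw [← hconj, h0]
    simp
  rw [h1, h2]
  refine hmain.congr_deriv (congrFun (congrFun ?_ i) j)
  simp only [Matrix.mul_add, Matrix.add_mul, Matrix.mul_sub, Matrix.sub_mul, Matrix.mul_smul,
    Matrix.smul_mul, Matrix.transpose_mul, Matrix.mul_assoc]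
  abel

/-- Along the closed loop, the derivative of `xᵀ W⁻¹ x` is `-4α xᵀ W⁻¹ x` minus squares. -/
theorem closedLoop_lyapunov_identity {n m p q : ℕ} {A W Q : Matrix (Fin n) (Fin n) ℝ}
    (B : Matrix (Fin n) (Fin m) ℝ) (C : Matrix (Fin n) (Fin q) ℝ)
    (X : Matrix (Fin n) (Fin p) ℝ) (a e : ℝ)
    (hWQ : W * Q = 1) (hQW : Q * W = 1) (hQ : Qᵀ = Q) :
    (((A + B * (-(Bᵀ * Q))) * X)ᵀ * Q
        + Xᵀ * (-(Q * (A * W + W * Aᵀ + a • W + e • (C * Cᵀ) - B * Bᵀ) * Q))) * X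
      + Xᵀ * Q * ((A + B * (-(Bᵀ * Q))) * X)
      = -(a • (Xᵀ * Q * X)) - e • ((Cᵀ * Q * X)ᵀ * (Cᵀ * Q * X))
        - (Bᵀ * Q * X)ᵀ * (Bᵀ * Q * X) := by
  have h1 : ∀ {r : ℕ} (Z : Matrix (Fin n) (Fin r) ℝ), W * (Q * Z) = Z := fun Z => by
    rw [← Matrix.mul_assoc, hWQ, Matrix.one_mul]
  have h2 : ∀ {r : ℕ} (Z : Matrix (Fin n) (Fin r) ℝ), Q * (W * Z) = Z := fun Z => by
    rw [← Matrix.mul_assoc, hQW, Matrix.one_mul]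
  simp only [Matrix.mul_add, Matrix.add_mul, Matrix.mul_sub, Matrix.sub_mul, Matrix.mul_smul,
    Matrix.smul_mul, Matrix.transpose_mul, Matrix.transpose_add, Matrix.transpose_neg,
    Matrix.mul_neg, Matrix.neg_mul, Matrix.mul_assoc, Matrix.transpose_transpose, hQ, h1, h2]
  abel

theorem dotProduct_self_nonneg_real {n : ℕ} (v : Fin n → ℝ) : 0 ≤ v ⬝ᵥ v :=
  Finset.sum_nonneg fun i _ => mul_self_nonneg (v i)

/-- If `c I ≤ W ≤ d I` then `W⁻¹` lies between `d⁻¹ I` and `c⁻¹ I`, as quadratic forms. -/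
theorem inverse_quadratic_bounds {n : ℕ} {W Q : Matrix (Fin n) (Fin n) ℝ} {c d : ℝ}
    (hd : 0 < d) (hc : 0 < c) (hWQ : W * Q = 1) (hW : Wᵀ = W)
    (hlow : ∀ v, c * (v ⬝ᵥ v) ≤ v ⬝ᵥ (W *ᵥ v)) (hup : ∀ v, v ⬝ᵥ (W *ᵥ v) ≤ d * (v ⬝ᵥ v))
    (x : Fin n → ℝ) :
    x ⬝ᵥ x ≤ d * (x ⬝ᵥ (Q *ᵥ x)) ∧ c * (x ⬝ᵥ (Q *ᵥ x)) ≤ x ⬝ᵥ x := by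
  set y := Q *ᵥ x with hy
  have hWy : W *ᵥ y = x := by rw [hy, Matrix.mulVec_mulVec, hWQ, Matrix.one_mulVec]
  have hsym : y ⬝ᵥ (W *ᵥ x) = x ⬝ᵥ x := by
    rw [Matrix.dotProduct_mulVec, ← Matrix.mulVec_transpose, hW, hWy]
  have hyx : y ⬝ᵥ x = x ⬝ᵥ y := dotProduct_comm _ _
  have hnn : ∀ v, 0 ≤ v ⬝ᵥ (W *ᵥ v) := fun v =>
    (mul_nonneg hc.le (dotProduct_self_nonneg_real v)).trans (hlow v)
  constructor
  · have h := hnn (x - d • y)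
    simp only [Matrix.mulVec_sub, Matrix.mulVec_smul, hWy, dotProduct_sub, sub_dotProduct,
      dotProduct_smul, smul_dotProduct, hsym, hyx, smul_eq_mul] at h
    have h' := hup x
    refine le_of_mul_le_mul_left ?_ hd
    nlinarith
  · have h := dotProduct_self_nonneg_real (x - c • y)
    simp only [dotProduct_sub, sub_dotProduct,
      dotProduct_smul, smul_dotProduct, hyx, smul_eq_mul] at h
    have h' := hlow y
    rw [hWy, hyx] at h'
    nlinarith

theorem euclNorm_eq_sqrt_dotProduct {n : ℕ} (x : Fin n → ℝ) :
    euclNorm x = Real.sqrt (x ⬝ᵥ x) := by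
  simp only [euclNorm, dotProduct, sq]

/-- Gramian exponential stability criterion via state feedback (continuous case):
if ε₁I ≤ G₀(t, t+δ) ≤ ε₂I for all t, then G_α(t, t+δ) is invertible and the feedback
gain K(t) = -B(t)ᵀ G_α(t, t+δ)⁻¹ makes the closed-loop system x' = (A + BK)x uniformly
exponentially stable with rate α. -/
theorem gramian_exponential_stability_continuous {n m : ℕ}
    (A : ℝ → Matrix (Fin n) (Fin n) ℝ) (B : ℝ → Matrix (Fin n) (Fin m) ℝ)
    (hA : ∀ i j, Continuous fun t => A t i j)
    (hB : ∀ i j, Continuous fun t => B t i j)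
    (Φ : ℝ → ℝ → Matrix (Fin n) (Fin n) ℝ)
    (hΦ0 : ∀ s : ℝ, Φ s s = 1)
    (hΦderiv : ∀ s t : ℝ, ∀ i j, HasDerivAt (fun τ => Φ τ s i j) ((A t * Φ t s) i j) t)
    (hΦmul : ∀ t s r : ℝ, Φ t s * Φ s r = Φ t r)
    (hΦinv : ∀ t s : ℝ, Φ t s * Φ s t = 1)
    (δ α : ℝ) (hδ : 0 < δ) (hα : 0 < α)
    (ε₁ ε₂ : ℝ) (hε₁ : 0 < ε₁) (hε₂ : 0 < ε₂)
    (hlow : ∀ t : ℝ,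
      (cGram Φ B 0 t (t + δ) - ε₁ • (1 : Matrix (Fin n) (Fin n) ℝ)).PosSemidef)
    (hup : ∀ t : ℝ,
      (ε₂ • (1 : Matrix (Fin n) (Fin n) ℝ) - cGram Φ B 0 t (t + δ)).PosSemidef) :
    (∀ t : ℝ, IsUnit (cGram Φ B α t (t + δ))) ∧
    ∃ γ : ℝ, 0 < γ ∧ ∀ x : ℝ → Fin n → ℝ,
      (∀ t : ℝ, ∀ i, HasDerivAt (fun τ => x τ i)
        ((A t + B t * (-((B t)ᵀ * (cGram Φ B α t (t + δ))⁻¹))).mulVec (x t) i) t) →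
      ∀ t₀ t : ℝ, t₀ ≤ t →
        euclNorm (x t) ≤ γ * Real.exp (-α * (t - t₀)) * euclNorm (x t₀) := by
  have hBc : Continuous B := continuous_pi fun i => continuous_pi fun j => hB i j
  have hΦ0c : Continuous (Φ 0) := continuous_iff_continuousAt.2 fun t =>
    continuousAt_right_inverse (P := fun s => Φ s 0)
      (fun i j => (hΦderiv 0 t i j).continuousAt) fun s => hΦinv s 0
  have hΦc : ∀ t, Continuous (Φ t) := fun t => by
    have h : Φ t = fun s => Φ t 0 * Φ 0 s := funext fun s => (hΦmul t 0 s).symm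
    rw [h]
    exact continuous_const.matrix_mul hΦ0c
  set W : ℝ → Matrix (Fin n) (Fin n) ℝ := fun t => cGram Φ B α t (t + δ) with hWdef
  set c : ℝ := Real.exp (-(4 * α) * δ) * ε₁ with hc_def
  have hc : 0 < c := mul_pos (Real.exp_pos _) hε₁
  have hWsymm : ∀ t, (W t)ᵀ = W t := fun t => cGram_transpose Φ B α t (t + δ)
  have hWlow : ∀ t v, c * (v ⬝ᵥ v) ≤ v ⬝ᵥ (W t *ᵥ v) := by
    intro t v
    have h := (hlow t).dotProduct_mulVec_nonneg v
    simp only [star_trivial, Matrix.sub_mulVec, Matrix.smul_mulVec, Matrix.one_mulVec,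
      dotProduct_sub, dotProduct_smul, smul_eq_mul, sub_nonneg] at h
    rw [hc_def, mul_assoc]
    exact (mul_le_mul_of_nonneg_left h (Real.exp_pos _).le).trans
      (cGram_weight_bounds hBc (hΦc t) hα.le hδ.le v).1
  have hWup : ∀ t v, v ⬝ᵥ (W t *ᵥ v) ≤ ε₂ * (v ⬝ᵥ v) := by
    intro t v
    have h := (hup t).dotProduct_mulVec_nonneg v
    simp only [star_trivial, Matrix.sub_mulVec, Matrix.smul_mulVec, Matrix.one_mulVec,
      dotProduct_sub, dotProduct_smul, smul_eq_mul, sub_nonneg] at h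
    exact (cGram_weight_bounds hBc (hΦc t) hα.le hδ.le v).2.trans h
  have hunit : ∀ t, IsUnit (W t) := fun t => by
    refine (Matrix.PosDef.of_dotProduct_mulVec_pos ?_ fun v hv => ?_).isUnit
    · rw [Matrix.IsHermitian, Matrix.conjTranspose_eq_transpose_of_trivial, hWsymm]
    · have hpos : 0 < v ⬝ᵥ v :=
        lt_of_le_of_ne (dotProduct_self_nonneg_real v) fun h => hv (dotProduct_self_eq_zero.1 h.symm)
      exact (mul_pos hc hpos).trans_le (hWlow t v)
  have hWQ : ∀ t, W t * (W t)⁻¹ = 1 := fun t =>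
    Matrix.mul_nonsing_inv _ ((Matrix.isUnit_iff_isUnit_det _).1 (hunit t))
  have hQW : ∀ t, (W t)⁻¹ * W t = 1 := fun t => mul_eq_one_comm.1 (hWQ t)
  have hQsymm : ∀ t, ((W t)⁻¹)ᵀ = (W t)⁻¹ := fun t => by
    rw [Matrix.transpose_nonsing_inv, hWsymm]
  refine ⟨hunit, Real.sqrt (ε₂ / c), Real.sqrt_pos.2 (div_pos hε₂ hc), fun x hx t₀ t ht => ?_⟩
  set V : ℝ → ℝ := fun t => x t ⬝ᵥ ((W t)⁻¹ *ᵥ x t) with hVdef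
  have hVderiv : ∀ τ, ∃ r, HasDerivAt V r τ ∧ r ≤ -(4 * α) * V τ := by
    intro τ
    set X : ℝ → Matrix (Fin n) (Fin 1) ℝ := fun s => Matrix.of fun i _ => x s i with hXdef
    have hX : ∀ i j, HasDerivAt (fun s => X s i j)
        (((A τ + B τ * (-((B τ)ᵀ * (W τ)⁻¹))) * X τ) i j) τ := fun i j => hx τ i
    have hVX : ∀ s, V s = ((X s)ᵀ * (W s)⁻¹ * X s) 0 0 := fun s => by
      rw [Matrix.mul_assoc]
      rfl
    have hsq : ∀ {l : ℕ} (Z : Matrix (Fin l) (Fin 1) ℝ), 0 ≤ (Zᵀ * Z) 0 0 := fun Z => by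
      rw [Matrix.mul_apply]
      exact Finset.sum_nonneg fun i _ => mul_self_nonneg (Z i 0)
    have hQ' := hasDerivAt_entry_right_inverse
      (hasDerivAt_cGram hBc hΦderiv hΦmul hΦinv hΦc α δ τ) hWQ
    have h := hasDerivAt_entry_mul (hasDerivAt_entry_mul (M := fun s => (X s)ᵀ)
      (M' := ((A τ + B τ * (-((B τ)ᵀ * (W τ)⁻¹))) * X τ)ᵀ) (fun i j => hX j i) hQ') hX 0 0
    rw [closedLoop_lyapunov_identity _ _ _ _ _ (hWQ τ) (hQW τ) (hQsymm τ)] at h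
    refine ⟨_, h.congr_of_eventuallyEq (Filter.Eventually.of_forall hVX), ?_⟩
    simp only [Matrix.sub_apply, Matrix.neg_apply, Matrix.smul_apply, smul_eq_mul, hVX τ]
    have h1 := mul_nonneg (Real.exp_pos (-(4 * α) * δ)).le
      (hsq ((Φ τ (τ + δ) * B (τ + δ))ᵀ * (W τ)⁻¹ * X τ))
    have h2 := hsq ((B τ)ᵀ * (W τ)⁻¹ * X τ)
    linarith
  have hanti : Antitone fun τ => Real.exp (4 * α * τ) * V τ := by
    have hd : ∀ τ, ∃ r, HasDerivAt (fun τ => Real.exp (4 * α * τ) * V τ) r τ ∧ r ≤ 0 := by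
      intro τ
      obtain ⟨r, hr, hle⟩ := hVderiv τ
      have hexp : HasDerivAt (fun τ => Real.exp (4 * α * τ))
          (Real.exp (4 * α * τ) * (4 * α)) τ := by
        simpa using ((hasDerivAt_id τ).const_mul (4 * α)).exp
      refine ⟨_, hexp.mul hr, ?_⟩
      have := mul_nonneg (Real.exp_pos (4 * α * τ)).le (sub_nonneg.2 hle)
      linarith
    refine antitone_of_deriv_nonpos (fun τ => ?_) fun τ => ?_ <;>
      obtain ⟨r, hr, hle⟩ := hd τ
    · exact hr.differentiableAt
    · exact hr.deriv.trans_le hle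
  have hV := hanti ht
  simp only at hV
  have hlow' := (inverse_quadratic_bounds hε₂ hc (hWQ t) (hWsymm t) (hWlow t) (hWup t) (x t)).1
  have hup' := (inverse_quadratic_bounds hε₂ hc (hWQ t₀) (hWsymm t₀) (hWlow t₀) (hWup t₀) (x t₀)).2
  have hVt : V t ≤ Real.exp (-(4 * α) * (t - t₀)) * V t₀ := by
    have he : Real.exp (-(4 * α) * (t - t₀))
        = (Real.exp (4 * α * t))⁻¹ * Real.exp (4 * α * t₀) := by
      rw [← Real.exp_neg, ← Real.exp_add]
      ring_nf
    rw [he, mul_assoc, le_inv_mul_iff₀ (Real.exp_pos _)]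
    exact hV
  have hV0 : V t₀ ≤ (x t₀ ⬝ᵥ x t₀) / c := by
    rw [le_div_iff₀ hc, mul_comm]
    exact hup'
  have hexp : Real.exp (-(4 * α) * (t - t₀)) ≤ Real.exp (-α * (t - t₀)) ^ 2 := by
    rw [← Real.exp_nat_mul]
    refine Real.exp_le_exp.2 ?_
    push_cast
    nlinarith [mul_nonneg hα.le (sub_nonneg.2 ht)]
  have hfinal : x t ⬝ᵥ x t
      ≤ ε₂ / c * Real.exp (-α * (t - t₀)) ^ 2 * (x t₀ ⬝ᵥ x t₀) := by
    have hnn := div_nonneg (dotProduct_self_nonneg_real (x t₀)) hc.le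
    calc x t ⬝ᵥ x t ≤ ε₂ * V t := hlow'
      _ ≤ ε₂ * (Real.exp (-α * (t - t₀)) ^ 2 * ((x t₀ ⬝ᵥ x t₀) / c)) := by
        refine mul_le_mul_of_nonneg_left (hVt.trans ?_) hε₂.le
        exact (mul_le_mul_of_nonneg_left hV0 (Real.exp_pos _).le).trans
          (mul_le_mul_of_nonneg_right hexp hnn)
      _ = _ := by ring
  rw [euclNorm_eq_sqrt_dotProduct, euclNorm_eq_sqrt_dotProduct]
  refine (Real.sqrt_le_sqrt hfinal).trans_eq ?_
  rw [Real.sqrt_mul (by positivity), Real.sqrt_mul (by positivity),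
    Real.sqrt_sq (Real.exp_pos _).le]
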